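/- For every integer q ≥ 2, let G_q be the graph with vertex set (ℤ/7ℤ) × {1,…,q} in which (i,a) and (j,b) are adjacent if and only if i − j ∈ {1, −1} (mod 7), or i = j and a ≠ b (the lexicographic product C_7[K_q]). Then G_q is well-covered with α(G_q) = 3, G_q is α-critical, G_q ∈ W_q, and G_q ∉ W_{q+1} (so its W-index is w(G_q) = q). -/

import Mathlib

open Finset
open scoped Classical

/-- `S` is an independent set of the graph `G`. -/
def IsIndep {V : Type*} (G : SimpleGraph V) (S : Finset V) : Prop :=
  ∀ ⦃x⦄, x ∈ S → ∀ ⦃y⦄, y ∈ S → x ≠ y → ¬ G.Adj x y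

/-- The independence number `α(G)` of a finite graph `G`. -/
noncomputable def alpha {V : Type*} [Fintype V] (G : SimpleGraph V) : ℕ :=
  Finset.univ.sup fun S : Finset V => if IsIndep G S then S.card else 0

/-- `S` is a maximum independent set of `G`. -/
def IsMaxIndep {V : Type*} [Fintype V] (G : SimpleGraph V) (S : Finset V) : Prop :=
  IsIndep G S ∧ S.card = alpha G

/-- `S` is a maximal (inclusion-wise) independent set of `G`. -/
def IsMaximalIndep {V : Type*} [DecidableEq V] (G : SimpleGraph V) (S : Finset V) : Prop :=
  IsIndep G S ∧ ∀ x, x ∉ S → ¬ IsIndep G (insert x S)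

/-- `G` is well-covered: every maximal independent set has cardinality `α(G)`. -/
def WellCovered {V : Type*} [Fintype V] [DecidableEq V] (G : SimpleGraph V) : Prop :=
  ∀ S : Finset V, IsMaximalIndep G S → S.card = alpha G

/-- `G ∈ W_p`: `|V(G)| ≥ p` and every `p` pairwise disjoint independent sets extend to
`p` pairwise disjoint maximum independent sets. -/
def MemW {V : Type*} [Fintype V] (G : SimpleGraph V) (p : ℕ) : Prop :=
  p ≤ Fintype.card V ∧
    ∀ A : Fin p → Finset V, (∀ i, IsIndep G (A i)) →
      (∀ i j, i ≠ j → Disjoint (A i) (A j)) →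
      ∃ M : Fin p → Finset V, (∀ i, IsMaxIndep G (M i)) ∧
        (∀ i j, i ≠ j → Disjoint (M i) (M j)) ∧ ∀ i, A i ⊆ M i

/-- The `W`-index of `G`: the largest `p` with `G ∈ W_p`. -/
noncomputable def wIndex {V : Type*} [Fintype V] (G : SimpleGraph V) : ℕ :=
  sSup {p : ℕ | MemW G p}

/-- The fiber `F_G(S)`: the vertices `x ∉ S` with `S ∪ {x}` a maximum independent set. -/
noncomputable def fiber {V : Type*} [Fintype V] [DecidableEq V]
    (G : SimpleGraph V) (S : Finset V) : Finset V :=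
  Finset.univ.filter fun x => x ∉ S ∧ IsMaxIndep G (insert x S)

/-- `G` is `α`-critical: deleting any edge increases the independence number. -/
def AlphaCritical {V : Type*} [Fintype V] (G : SimpleGraph V) : Prop :=
  ∀ x y, G.Adj x y → alpha G < alpha (G.deleteEdges {s(x, y)})

/-- `H` is `K_t`-saturated: `H` is `K_t`-free but adding any missing edge creates a `K_t`. -/
def KSaturated {V : Type*} [Fintype V] (H : SimpleGraph V) (t : ℕ) : Prop :=
  (∀ Q : Finset V, ¬ H.IsNClique t Q) ∧
    ∀ x y : V, x ≠ y → ¬ H.Adj x y →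
      ∃ Q : Finset V, (H ⊔ SimpleGraph.fromEdgeSet {s(x, y)}).IsNClique t Q

/-- `Q` is an inclusion-maximal clique of `H`. -/
def IsMaximalClique {V : Type*} [DecidableEq V] (H : SimpleGraph V) (Q : Finset V) : Prop :=
  H.IsClique (Q : Set V) ∧ ∀ x, x ∉ Q → ¬ H.IsClique ((insert x Q : Finset V) : Set V)

/-- The `(r-1)`-clique-codegree of `Q` in `H`: the number of vertices extending `Q`
to an `r`-clique of `H`. -/
noncomputable def codeg {V : Type*} [Fintype V] [DecidableEq V]
    (H : SimpleGraph V) (r : ℕ) (Q : Finset V) : ℕ :=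
  (Finset.univ.filter fun x => x ∉ Q ∧ H.IsNClique r (insert x Q)).card

/-- The minimum `(r-1)`-clique-codegree `δ^cl_{r-1}(H)`. -/
noncomputable def minCliqueCodeg {V : Type*} [Fintype V] [DecidableEq V]
    (H : SimpleGraph V) (r : ℕ) : ℕ :=
  sInf {m : ℕ | ∃ Q : Finset V, H.IsNClique (r - 1) Q ∧ codeg H r Q = m}

/-- The vertex set of the localization `G_S = G - N_G[S]`. -/
noncomputable def localVerts {V : Type*} [Fintype V] (G : SimpleGraph V) (S : Finset V) :
    Finset V :=
  Finset.univ.filter fun v => v ∉ S ∧ ∀ s ∈ S, ¬ G.Adj s v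

/-- The localization `G_S = G - N_G[S]`, as an induced subgraph. -/
noncomputable def localize {V : Type*} [Fintype V] (G : SimpleGraph V) (S : Finset V) :
    SimpleGraph {v : V // v ∈ localVerts G S} :=
  SimpleGraph.comap (fun v => (v : V)) G

/-- The vertex set of the edge-localization `G_{ab} = G - (N_G(a) ∪ N_G(b))`. -/
noncomputable def edgeVerts {V : Type*} [Fintype V] (G : SimpleGraph V) (a b : V) : Finset V :=
  Finset.univ.filter fun v => ¬ G.Adj a v ∧ ¬ G.Adj b v

/-- The edge-localization `G_{ab} = G - (N_G(a) ∪ N_G(b))`, as an induced subgraph. -/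
noncomputable def edgeLocalize {V : Type*} [Fintype V] (G : SimpleGraph V) (a b : V) :
    SimpleGraph {v : V // v ∈ edgeVerts G a b} :=
  SimpleGraph.comap (fun v => (v : V)) G

/-- The clique blow-up `C_7[K_q]`: vertices `(ℤ/7ℤ) × Fin q`, with `(i,a)` adjacent to
`(j,b)` iff `i - j ∈ {1, -1}` or (`i = j` and `a ≠ b`). -/
def Gq (q : ℕ) : SimpleGraph (ZMod 7 × Fin q) :=
  SimpleGraph.fromRel fun x y => x.1 - y.1 = 1 ∨ x.1 = y.1

theorem IsIndep.card_le_alpha {V : Type*} [Fintype V] {G : SimpleGraph V} {S : Finset V}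
    (h : IsIndep G S) : S.card ≤ alpha G := by
  have := Finset.le_sup (f := fun S : Finset V => if IsIndep G S then S.card else 0)
    (Finset.mem_univ S)
  simpa [h, alpha] using this

theorem alpha_le {V : Type*} [Fintype V] {G : SimpleGraph V} {n : ℕ}
    (h : ∀ S, IsIndep G S → S.card ≤ n) : alpha G ≤ n := by
  refine Finset.sup_le fun S _ => ?_
  split_ifs with hS
  · exact h S hS
  · exact Nat.zero_le n

theorem IsIndep.insert_of_not_adj {V : Type*} [DecidableEq V] {G : SimpleGraph V}
    {S : Finset V} {v : V}
    (h : IsIndep G S) (hv : ∀ x ∈ S, ¬ G.Adj v x) : IsIndep G (insert v S) := by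
  intro x hx y hy hne hadj
  rw [Finset.mem_insert] at hx hy
  rcases hx with rfl | hx <;> rcases hy with rfl | hy
  · exact hne rfl
  · exact hv y hy hadj
  · exact hv x hx hadj.symm
  · exact h hx hy hne hadj

theorem isIndep_empty {V : Type*} (G : SimpleGraph V) : IsIndep G ∅ := by
  intro x hx
  simp at hx

theorem isIndep_singleton {V : Type*} (G : SimpleGraph V) (v : V) : IsIndep G {v} := by
  intro x hx y hy hne
  rw [Finset.mem_singleton] at hx hy
  exact absurd (hx.trans hy.symm) hne

theorem Gq_adj {q : ℕ} {x y : ZMod 7 × Fin q} :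
    (Gq q).Adj x y ↔ x ≠ y ∧ (x.1 - y.1 = 1 ∨ y.1 - x.1 = 1 ∨ x.1 = y.1) := by
  rw [Gq, SimpleGraph.fromRel_adj]
  constructor
  · rintro ⟨h, (h1 | h1) | (h1 | h1)⟩ <;> simp [h, h1]
  · rintro ⟨h, h1 | h1 | h1⟩ <;> simp [h, h1]

/-- Two vertices of an independent set of `Gq q` have equal or distance-`≥ 2` positions,
and equal positions force equality. -/
theorem IsIndep.Gq_positions {q : ℕ} {S : Finset (ZMod 7 × Fin q)} (hS : IsIndep (Gq q) S)
    {x y : ZMod 7 × Fin q} (hx : x ∈ S) (hy : y ∈ S) (hne : x ≠ y) :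
    x.1 - y.1 ≠ 1 ∧ y.1 - x.1 ≠ 1 ∧ x.1 ≠ y.1 := by
  have h := hS hx hy hne
  rw [Gq_adj] at h
  tauto

theorem IsIndep.Gq_card_le {q : ℕ} {S : Finset (ZMod 7 × Fin q)} (hS : IsIndep (Gq q) S) :
    S.card ≤ 3 := by
  have h1 : (S.image Prod.fst).card = S.card :=
    Finset.card_image_of_injOn fun x hx y hy hxy => by
      by_contra hne
      exact (hS.Gq_positions hx hy hne).2.2 hxy
  have h2 : (S.image fun x => x.1 + 1).card = S.card :=
    Finset.card_image_of_injOn fun x hx y hy hxy => by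
      by_contra hne
      exact (hS.Gq_positions hx hy hne).2.2 (add_right_cancel hxy)
  have h3 : Disjoint (S.image Prod.fst) (S.image fun x => x.1 + 1) := by
    rw [Finset.disjoint_left]
    intro c hc hc'
    obtain ⟨x, hx, rfl⟩ := Finset.mem_image.1 hc
    obtain ⟨y, hy, hxy⟩ := Finset.mem_image.1 hc'
    have hsub : x.1 - y.1 = 1 := by rw [← hxy]; ring
    by_cases hne : x = y
    · subst hne
      rw [sub_self] at hsub
      exact absurd hsub (by decide)
    · exact (hS.Gq_positions hx hy hne).1 hsub
  have h4 := Finset.card_le_univ ((S.image Prod.fst) ∪ (S.image fun x => x.1 + 1))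
  rw [Finset.card_union_of_disjoint h3, h1, h2, ZMod.card] at h4
  omega

theorem exists_far_position (i j : ZMod 7) (h : i - j ≠ 1) (h' : j - i ≠ 1) :
    ∃ c, (c - i ≠ 1 ∧ i - c ≠ 1 ∧ c ≠ i) ∧ (c - j ≠ 1 ∧ j - c ≠ 1 ∧ c ≠ j) := by
  revert i j
  decide

/-- An independent set with fewer than three vertices misses, together with its neighbours,
some clique fiber `{c} × Fin q`. -/
theorem IsIndep.Gq_exists_free_position {q : ℕ} {S : Finset (ZMod 7 × Fin q)}
    (hS : IsIndep (Gq q) S) (hcard : S.card < 3) :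
    ∃ c : ZMod 7, ∀ x ∈ S, c - x.1 ≠ 1 ∧ x.1 - c ≠ 1 ∧ c ≠ x.1 := by
  interval_cases h : S.card
  · rw [Finset.card_eq_zero] at h
    subst h
    exact ⟨0, by simp⟩
  · obtain ⟨x, rfl⟩ := Finset.card_eq_one.1 h
    obtain ⟨c, hc, -⟩ := exists_far_position x.1 x.1 (by rw [sub_self]; decide)
      (by rw [sub_self]; decide)
    exact ⟨c, by simpa using hc⟩
  · obtain ⟨x, y, hne, rfl⟩ := Finset.card_eq_two.1 h
    have hxy := hS.Gq_positions (x := x) (y := y) (by simp) (by simp) hne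
    obtain ⟨c, hc, hc'⟩ := exists_far_position x.1 y.1 hxy.1 hxy.2.1
    refine ⟨c, fun z hz => ?_⟩
    rw [Finset.mem_insert, Finset.mem_singleton] at hz
    rcases hz with rfl | rfl
    · exact hc
    · exact hc'

theorem IsIndep.Gq_insert {q : ℕ} {S : Finset (ZMod 7 × Fin q)} (hS : IsIndep (Gq q) S)
    {c : ZMod 7} (hc : ∀ x ∈ S, c - x.1 ≠ 1 ∧ x.1 - c ≠ 1 ∧ c ≠ x.1) (a : Fin q) :
    IsIndep (Gq q) (insert (c, a) S) := by
  refine hS.insert_of_not_adj fun x hx hadj => ?_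
  have := hc x hx
  have := (Gq_adj.1 hadj).2
  tauto

theorem Gq_alpha {q : ℕ} (hq : 0 < q) : alpha (Gq q) = 3 := by
  refine le_antisymm (alpha_le fun S hS => hS.Gq_card_le) ?_
  by_contra hlt
  obtain ⟨S, hS, hmax⟩ : ∃ S, IsIndep (Gq q) S ∧ ∀ T, IsIndep (Gq q) T → T.card ≤ S.card := by
    obtain ⟨S, hS, hmax⟩ := (Finset.univ.filter fun S => IsIndep (Gq q) S).exists_max_image
      Finset.card ⟨∅, by simpa using isIndep_empty _⟩
    exact ⟨S, (Finset.mem_filter.1 hS).2, fun T hT => hmax T (by simpa using hT)⟩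
  have hcard := hS.card_le_alpha
  obtain ⟨c, hc⟩ := hS.Gq_exists_free_position (by omega)
  have h := hmax _ (hS.Gq_insert hc ⟨0, hq⟩)
  rw [Finset.card_insert_of_notMem fun hmem => (hc _ hmem).2.2 rfl] at h
  omega

theorem Gq_wellCovered {q : ℕ} (hq : 0 < q) : WellCovered (Gq q) := by
  rintro S ⟨hS, hmax⟩
  rw [Gq_alpha hq]
  refine le_antisymm hS.Gq_card_le ?_
  by_contra hlt
  obtain ⟨c, hc⟩ := hS.Gq_exists_free_position (by omega)
  refine hmax (c, ⟨0, hq⟩) (fun hmem => (hc _ hmem).2.2 rfl) ?_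
  convert hS.Gq_insert hc ⟨0, hq⟩

/-- The edge `xy` together with two further positions is independent once `xy` is deleted. -/
theorem four_le_alpha_Gq_deleteEdges {q : ℕ} {x y : ZMod 7 × Fin q} (hne : x ≠ y)
    (h : y.1 - x.1 = 1 ∨ x.1 = y.1) : 4 ≤ alpha ((Gq q).deleteEdges {s(x, y)}) := by
  obtain ⟨i, a⟩ := x
  obtain ⟨j, b⟩ := y
  have hfar : ∀ i j : ZMod 7, (j - i = 1 ∨ i = j) → ∃ k l,
      (k - i ≠ 1 ∧ i - k ≠ 1 ∧ k ≠ i) ∧ (k - j ≠ 1 ∧ j - k ≠ 1 ∧ k ≠ j) ∧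
      (l - i ≠ 1 ∧ i - l ≠ 1 ∧ l ≠ i) ∧ (l - j ≠ 1 ∧ j - l ≠ 1 ∧ l ≠ j) ∧
      (l - k ≠ 1 ∧ k - l ≠ 1 ∧ l ≠ k) := fun i j h => ⟨i + 3, i + 5, by revert i j; decide⟩
  obtain ⟨k, l, h1, h2, h3, h4, h5⟩ := hfar i j h
  have hind : IsIndep ((Gq q).deleteEdges {s((i, a), (j, b))})
      {(l, a), (k, a), (i, a), (j, b)} := by
    refine (((isIndep_singleton _ _).insert_of_not_adj ?_).insert_of_not_adj
      ?_).insert_of_not_adj ?_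
    · simp
    · simp only [Finset.mem_insert, Finset.mem_singleton, SimpleGraph.deleteEdges_adj, Gq_adj]
      rintro z (rfl | rfl) ⟨⟨-, hz⟩, -⟩
      · simp [h1] at hz
      · simp [h2] at hz
    · simp only [Finset.mem_insert, Finset.mem_singleton, SimpleGraph.deleteEdges_adj, Gq_adj]
      rintro z (rfl | rfl | rfl) ⟨⟨-, hz⟩, -⟩
      · simp [h5] at hz
      · simp [h3] at hz
      · simp [h4] at hz
  have hcard : ({(l, a), (k, a), (i, a), (j, b)} : Finset (ZMod 7 × Fin q)).card = 4 := by
    rw [Finset.card_insert_of_notMem, Finset.card_insert_of_notMem, Finset.card_pair hne]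
    · simp [h1, h2]
    · simp [h3, h4, h5]
  exact hcard ▸ hind.card_le_alpha

theorem Gq_alphaCritical {q : ℕ} (hq : 0 < q) : AlphaCritical (Gq q) := by
  intro x y hadj
  obtain ⟨hne, h⟩ := Gq_adj.1 hadj
  rw [Gq_alpha hq]
  rcases h with h | h
  · rw [Sym2.eq_swap]
    exact four_le_alpha_Gq_deleteEdges hne.symm (Or.inl h)
  · exact four_le_alpha_Gq_deleteEdges hne h

/-- Among `q` independent sets one of which avoids the fiber over `c`, some vertex of that
fiber lies in none of the sets. -/
theorem exists_vertex_avoiding {q : ℕ} {M : Fin q → Finset (ZMod 7 × Fin q)}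
    (hind : ∀ i, IsIndep (Gq q) (M i)) {c : ZMod 7} {i : Fin q}
    (hi : ∀ a, (c, a) ∉ M i) : ∃ a, ∀ j, (c, a) ∉ M j := by
  by_contra! hcov
  choose f hf using hcov
  have hinj : Function.Injective f := by
    intro a b hab
    by_contra hne
    have hb := hf b
    rw [← hab] at hb
    exact ((hind (f a)).Gq_positions (hf a) hb (by simpa using hne)).2.2 rfl
  obtain ⟨a, rfl⟩ := (Finite.injective_iff_surjective.1 hinj) i
  exact hi a (hf a)

theorem Gq_memW {q : ℕ} (hq : 0 < q) : MemW (Gq q) q := by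
  refine ⟨by simp [ZMod.card]; omega, fun A hA hdisj => ?_⟩
  obtain ⟨M, hAM, ⟨hind, hM⟩, hmax⟩ := Set.Finite.exists_le_maximal
    (s := {M : Fin q → Finset (ZMod 7 × Fin q) | (∀ i, IsIndep (Gq q) (M i)) ∧
      ∀ i j, i ≠ j → Disjoint (M i) (M j)}) (Set.toFinite _) (a := A) ⟨hA, hdisj⟩
  refine ⟨M, fun i => ⟨hind i, ?_⟩, hM, hAM⟩
  rw [Gq_alpha hq]
  refine le_antisymm (hind i).Gq_card_le ?_
  by_contra hlt
  obtain ⟨c, hc⟩ := (hind i).Gq_exists_free_position (by omega)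
  obtain ⟨a, ha⟩ := exists_vertex_avoiding hind (c := c) (i := i)
    fun a hmem => (hc _ hmem).2.2 rfl
  have hle : M ≤ Function.update M i (insert (c, a) (M i)) := by
    rw [le_update_self_iff]
    exact Finset.subset_insert _ _
  have hge := hmax (y := Function.update M i (insert (c, a) (M i))) ⟨fun j => ?_, ?_⟩ hle i
  · rw [Function.update_self] at hge
    exact ha i (hge (Finset.mem_insert_self _ _))
  · by_cases hj : j = i
    · subst hj
      rw [Function.update_self]
      exact (hind j).Gq_insert hc a
    · rw [Function.update_of_ne hj]
      exact hind j
  · intro j k hjk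
    by_cases hj : j = i
    · subst hj
      rw [Function.update_self, Function.update_of_ne hjk.symm, Finset.disjoint_insert_left]
      exact ⟨ha k, hM j k hjk⟩
    · rw [Function.update_of_ne hj]
      by_cases hk : k = i
      · subst hk
        rw [Function.update_self, Finset.disjoint_insert_right]
        exact ⟨ha j, hM j k hjk⟩
      · rw [Function.update_of_ne hk]
        exact hM j k hjk

/-- The pair `(0, 0), (3, 0)` extends to a maximum independent set only through the fiber
over `5`, whose `q` vertices can all be claimed by singletons. -/
theorem MemW.le_of_Gq {q p : ℕ} (hq : 0 < q) (h : MemW (Gq q) p) : p ≤ q := by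
  by_contra! hp
  let e : Fin q := ⟨0, hq⟩
  let A : Fin p → Finset (ZMod 7 × Fin q) := fun i =>
    if hi : (i : ℕ) < q then {(5, ⟨i, hi⟩)}
    else if (i : ℕ) = q then {(0, e), (3, e)} else ∅
  have h05 : (5 : ZMod 7) ≠ 0 := by decide
  have h35 : (5 : ZMod 7) ≠ 3 := by decide
  have hpair : IsIndep (Gq q) {((0 : ZMod 7), e), (3, e)} := by
    refine (isIndep_singleton _ _).insert_of_not_adj fun x hx => ?_
    rw [Finset.mem_singleton] at hx
    subst hx
    rw [Gq_adj]
    rintro ⟨-, h⟩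
    exact absurd h (by simp only; decide)
  have hA : ∀ i, IsIndep (Gq q) (A i) := by
    intro i
    simp only [A]
    split_ifs
    · exact isIndep_singleton _ _
    · exact hpair
    · exact isIndep_empty _
  have hdisj : ∀ i j, i ≠ j → Disjoint (A i) (A j) := by
    intro i j hij
    have hval : (i : ℕ) ≠ j := fun h => hij (Fin.ext h)
    simp only [A]
    split_ifs <;> simp [h05, h35, hval] <;> omega
  obtain ⟨M, hM, hMdisj, hAM⟩ := h.2 A hA hdisj
  let k : Fin p := ⟨q, hp⟩
  have hk : {((0 : ZMod 7), e), (3, e)} ⊆ M k := by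
    simpa [A, k] using hAM k
  have hne : ((0 : ZMod 7), e) ≠ (3, e) := fun h =>
    absurd (congrArg Prod.fst h) (by simp only; decide)
  obtain ⟨⟨c, a⟩, hx, hx'⟩ := Finset.exists_mem_notMem_of_card_lt_card
    (s := {((0 : ZMod 7), e), (3, e)}) (t := M k)
    (by rw [(hM k).2, Gq_alpha hq, Finset.card_pair hne]; omega)
  rw [Finset.mem_insert, Finset.mem_singleton, not_or] at hx'
  have h0 := (hM k).1.Gq_positions hx (hk (by simp)) hx'.1
  have h3 := (hM k).1.Gq_positions hx (hk (by simp)) hx'.2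
  have hc : ∀ c : ZMod 7, (c - 0 ≠ 1 ∧ 0 - c ≠ 1 ∧ c ≠ 0) →
      (c - 3 ≠ 1 ∧ 3 - c ≠ 1 ∧ c ≠ 3) → c = 5 := by decide
  obtain rfl : c = 5 := hc c h0 h3
  let l : Fin p := ⟨a, a.2.trans hp⟩
  have hl : ((5 : ZMod 7), a) ∈ M l := hAM l (by simp [A, l])
  have hkl : k ≠ l := fun h => a.2.ne' (congrArg Fin.val h)
  exact Finset.disjoint_left.1 (hMdisj k l hkl) hx hl

/-- The clique blow-up of `C_7`. -/
theorem Gq_properties (q : ℕ) (hq : 2 ≤ q) :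
    WellCovered (Gq q) ∧ alpha (Gq q) = 3 ∧ AlphaCritical (Gq q) ∧
      MemW (Gq q) q ∧ ¬ MemW (Gq q) (q + 1) ∧ wIndex (Gq q) = q := by
  have hq0 : 0 < q := by omega
  refine ⟨Gq_wellCovered hq0, Gq_alpha hq0, Gq_alphaCritical hq0, Gq_memW hq0,
    fun h => absurd (h.le_of_Gq hq0) (by omega), ?_⟩
  exact IsGreatest.csSup_eq ⟨Gq_memW hq0, fun p hp => MemW.le_of_Gq hq0 hp⟩
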